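/- arXiv:2002.12406 — 6 statements merged into one kernel-verified Lean document; each statement's English description precedes it below -/
import Mathlib

section
/- Let X and Z be nonempty finite types, p a probability mass function on X with p x > 0 for all x, e : X → Z → ℝ an encoder (e x z ≥ 0, ∑_z e x z = 1 for each x), m a probability mass function on Z with m z > 0, and d : Z → X → ℝ a decoder with d z x > 0 and ∑_x d z x = 1 for each z. Then H ≤ D + R, where H = ∑_x p x·(-log p x), D = ∑_x p x · ∑_z e x z·(-log (d z x)), and R = ∑_x p x · ∑_z e x z · log(e x z / m z) (with 0·log 0 = 0). -/
open Real Finset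

/-- Pointwise form of Gibbs' inequality. -/
lemma sub_le_mul_log_div {a b : ℝ} (ha : 0 ≤ a) (hb : 0 < b) : a - b ≤ a * Real.log (a / b) := by
  rcases ha.eq_or_lt with rfl | ha
  · simpa using hb.le
  · calc a - b = a * (1 - (a / b)⁻¹) := by field_simp
      _ ≤ a * Real.log (a / b) :=
        mul_le_mul_of_nonneg_left (Real.one_sub_inv_le_log_of_pos (div_pos ha hb)) ha.le

/-- Pointwise form of Gibbs' inequality for products, with the logarithm expanded. -/
lemma mul_sub_mul_le_mul_log {p e m d : ℝ} (hp : 0 < p) (he : 0 ≤ e) (hm : 0 < m) (hd : 0 < d) :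
    p * e - m * d ≤ p * e * (Real.log p - Real.log d + Real.log (e / m)) := by
  rcases he.eq_or_lt with rfl | he'
  · simpa using (mul_pos hm hd).le
  · convert sub_le_mul_log_div (mul_nonneg hp.le he) (mul_pos hm hd) using 2
    rw [Real.log_div he'.ne' hm.ne', Real.log_div (by positivity) (by positivity),
      Real.log_mul hp.ne' he'.ne', Real.log_mul hm.ne' hd.ne']
    ring

/-- ELBO inequality `H ≤ D + R`: entropy is at most distortion plus rate. -/
theorem entropy_le_distortion_add_rate {X Z : Type*}
    [Fintype X] [Nonempty X] [Fintype Z] [Nonempty Z]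
    (p : X → ℝ) (hp : ∀ x, 0 < p x) (hp1 : ∑ x, p x = 1)
    (e : X → Z → ℝ) (he0 : ∀ x z, 0 ≤ e x z) (he1 : ∀ x, ∑ z, e x z = 1)
    (m : Z → ℝ) (hm : ∀ z, 0 < m z) (hm1 : ∑ z, m z = 1)
    (d : Z → X → ℝ) (hd : ∀ z x, 0 < d z x) (hd1 : ∀ z, ∑ x, d z x = 1) :
    ∑ x, p x * (-Real.log (p x)) ≤
      (∑ x, p x * ∑ z, e x z * (-Real.log (d z x))) +
      (∑ x, p x * ∑ z, e x z * Real.log (e x z / m z)) := by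
  have mass : ∑ x, ∑ z, (p x * e x z - m z * d z x) = 0 := by
    simp_rw [sum_sub_distrib]
    rw [sum_comm (f := fun x z => m z * d z x)]
    simp_rw [← mul_sum, he1, hd1, mul_one, hp1, hm1, sub_self]
  have gibbs : ∑ x, ∑ z, (p x * e x z - m z * d z x) ≤
      ∑ x, ∑ z, p x * e x z * (Real.log (p x) - Real.log (d z x) + Real.log (e x z / m z)) :=
    sum_le_sum fun x _ => sum_le_sum fun z _ =>
      mul_sub_mul_le_mul_log (hp x) (he0 x z) (hm z) (hd z x)
  have split : ∑ x, ∑ z, p x * e x z *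
        (Real.log (p x) - Real.log (d z x) + Real.log (e x z / m z)) =
      (∑ x, p x * ∑ z, e x z * (-Real.log (d z x))) +
      (∑ x, p x * ∑ z, e x z * Real.log (e x z / m z)) - ∑ x, p x * (-Real.log (p x)) := by
    rw [← sum_add_distrib, ← sum_sub_distrib]
    refine sum_congr rfl fun x _ => ?_
    have entropy : p x * (-Real.log (p x)) = ∑ z, e x z * (p x * (-Real.log (p x))) := by
      rw [← sum_mul, he1, one_mul]
    rw [entropy, mul_sum, mul_sum, ← sum_add_distrib, ← sum_sub_distrib]
    exact sum_congr rfl fun z _ => by ring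
  linarith
end

section
/- Let Z be a nonempty finite type and H : ℝ → Z → ℝ be such that for each z the map θ ↦ H θ z is twice differentiable. Then the free energy J(θ) = -log(∑_z exp(-(H θ z))) is twice differentiable, and J''(θ) = ⟨∂²H/∂θ²⟩ + ⟨∂H/∂θ⟩² - ⟨(∂H/∂θ)²⟩, where ⟨g⟩ = ∑_z p_θ z · g z denotes expectation under the Gibbs distribution p_θ z = exp(-(H θ z)) / ∑_{z'} exp(-(H θ z')). -/
open Real Finset

/-- The derivative of a Gibbs-weighted sum `∑_z exp(-H θ z) * g θ z`. -/
theorem hasDerivAt_sum_exp_neg_mul {Z : Type*} [Fintype Z] {H g : ℝ → Z → ℝ} {H' g' : Z → ℝ}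
    {θ : ℝ} (hH : ∀ z, HasDerivAt (fun t => H t z) (H' z) θ)
    (hg : ∀ z, HasDerivAt (fun t => g t z) (g' z) θ) :
    HasDerivAt (fun t => ∑ z, Real.exp (-(H t z)) * g t z)
      (∑ z, Real.exp (-(H θ z)) * g' z - ∑ z, Real.exp (-(H θ z)) * (H' z * g θ z)) θ := by
  rw [← Finset.sum_sub_distrib]
  refine HasDerivAt.fun_sum fun z _ => ?_
  refine ((hH z).fun_neg.exp.fun_mul (hg z)).congr_deriv ?_
  ring

/-- The derivative of the partition function. -/
theorem hasDerivAt_sum_exp_neg {Z : Type*} [Fintype Z] {H : ℝ → Z → ℝ} {H' : Z → ℝ}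
    {θ : ℝ} (hH : ∀ z, HasDerivAt (fun t => H t z) (H' z) θ) :
    HasDerivAt (fun t => ∑ z, Real.exp (-(H t z))) (-∑ z, Real.exp (-(H θ z)) * H' z) θ := by
  simpa using hasDerivAt_sum_exp_neg_mul hH (g := fun _ _ => 1) fun _ => hasDerivAt_const θ 1

/-- The partition function is positive. -/
theorem sum_exp_neg_pos {Z : Type*} [Fintype Z] [Nonempty Z] (E : Z → ℝ) :
    0 < ∑ z, Real.exp (-(E z)) :=
  Finset.sum_pos (fun _ _ => Real.exp_pos _) Finset.univ_nonempty

/-- The derivative of the free energy is the Gibbs expectation of the derivative of `H`. -/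
theorem hasDerivAt_free_energy {Z : Type*} [Fintype Z] [Nonempty Z] {H : ℝ → Z → ℝ} {H' : Z → ℝ}
    {θ : ℝ} (hH : ∀ z, HasDerivAt (fun t => H t z) (H' z) θ) :
    HasDerivAt (fun t => -Real.log (∑ z, Real.exp (-(H t z))))
      ((∑ z, Real.exp (-(H θ z)) * H' z) / ∑ z, Real.exp (-(H θ z))) θ := by
  refine ((hasDerivAt_sum_exp_neg hH).log (sum_exp_neg_pos (H θ)).ne').fun_neg.congr_deriv ?_
  rw [neg_div, neg_neg]

/-- The second derivative of the free energy `J θ = -log ∑_z exp(-H θ z)` equals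
`⟨∂²H/∂θ²⟩ + ⟨∂H/∂θ⟩² - ⟨(∂H/∂θ)²⟩`, where `⟨·⟩` is the Gibbs expectation. -/
theorem deriv2_free_energy {Z : Type*} [Fintype Z] [Nonempty Z]
    (H : ℝ → Z → ℝ)
    (hH : ∀ z, Differentiable ℝ fun θ => H θ z)
    (hH' : ∀ z, Differentiable ℝ (deriv fun θ => H θ z)) :
    Differentiable ℝ (fun θ => -Real.log (∑ z, Real.exp (-(H θ z)))) ∧
    Differentiable ℝ (deriv fun θ => -Real.log (∑ z, Real.exp (-(H θ z)))) ∧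
    ∀ θ : ℝ,
      deriv (deriv fun θ' => -Real.log (∑ z, Real.exp (-(H θ' z)))) θ =
        (∑ z, (Real.exp (-(H θ z)) / ∑ z', Real.exp (-(H θ z'))) *
            deriv (deriv fun θ' => H θ' z) θ)
        + (∑ z, (Real.exp (-(H θ z)) / ∑ z', Real.exp (-(H θ z'))) *
            deriv (fun θ' => H θ' z) θ) ^ 2
        - ∑ z, (Real.exp (-(H θ z)) / ∑ z', Real.exp (-(H θ z'))) *
            (deriv (fun θ' => H θ' z) θ) ^ 2 := by
  have h₁ (θ : ℝ) (z : Z) := (hH z θ).hasDerivAt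
  have h₂ (θ : ℝ) (z : Z) := (hH' z θ).hasDerivAt
  have hJ (θ : ℝ) := hasDerivAt_free_energy (h₁ θ)
  have hJ' (θ : ℝ) := (hasDerivAt_sum_exp_neg_mul (h₁ θ)
    (g := fun t z => deriv (fun θ' => H θ' z) t) (h₂ θ)).fun_div
    (hasDerivAt_sum_exp_neg (h₁ θ)) (sum_exp_neg_pos (H θ)).ne'
  rw [funext fun θ => (hJ θ).deriv]
  refine ⟨fun θ => (hJ θ).differentiableAt, fun θ => (hJ' θ).differentiableAt, fun θ => ?_⟩
  rw [(hJ' θ).deriv]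
  have hS := (sum_exp_neg_pos (H θ)).ne'
  simp only [div_mul_eq_mul_div, ← Finset.sum_div, ← pow_two]
  field_simp
  ring
end

section
/- Let Z be a nonempty finite type and H, g : ℝ → Z → ℝ be such that for each z the maps θ ↦ H θ z and θ ↦ g θ z are differentiable. Then θ ↦ ⟨g θ⟩_θ = ∑_z p_θ z · g θ z is differentiable, and its derivative at θ equals ⟨∂g/∂θ⟩_θ - ⟨g · ∂H/∂θ⟩_θ + ⟨g⟩_θ · ⟨∂H/∂θ⟩_θ, where p_θ z = exp(-(H θ z)) / ∑_{z'} exp(-(H θ z')) is the Gibbs distribution and ⟨·⟩_θ denotes expectation under p_θ. -/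
open Real Finset

/-- Derivative of the Gibbs weight of a single state: `∂p_z = p_z (⟨∂H⟩ - ∂H_z)`. -/
theorem hasDerivAt_gibbs_weight {Z : Type*} [Fintype Z] [Nonempty Z]
    {H : ℝ → Z → ℝ} {H' : Z → ℝ} {θ : ℝ}
    (hH : ∀ z, HasDerivAt (fun θ => H θ z) (H' z) θ) (z : Z) :
    HasDerivAt (fun θ => Real.exp (-(H θ z)) / ∑ z', Real.exp (-(H θ z')))
      ((Real.exp (-(H θ z)) / ∑ z', Real.exp (-(H θ z'))) *
        ((∑ w, (Real.exp (-(H θ w)) / ∑ z', Real.exp (-(H θ z'))) * H' w) - H' z)) θ := by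
  have hpos : 0 < ∑ z', Real.exp (-(H θ z')) :=
    Finset.sum_pos (fun _ _ => Real.exp_pos _) Finset.univ_nonempty
  have hexp (w : Z) : HasDerivAt (fun θ => Real.exp (-(H θ w)))
      (Real.exp (-(H θ w)) * -(H' w)) θ := (hH w).fun_neg.exp
  have hsum : HasDerivAt (fun θ => ∑ w, Real.exp (-(H θ w)))
      (∑ w, Real.exp (-(H θ w)) * -(H' w)) θ :=
    HasDerivAt.fun_sum fun w _ => hexp w
  refine ((hexp z).fun_div hsum hpos.ne').congr_deriv ?_
  simp only [div_mul_eq_mul_div, ← Finset.sum_div, mul_neg, Finset.sum_neg_distrib]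
  field_simp
  ring

/-- Derivative of a Gibbs expectation in covariance form. -/
theorem hasDerivAt_gibbs_expectation {Z : Type*} [Fintype Z] [Nonempty Z]
    {H g : ℝ → Z → ℝ} {H' g' : Z → ℝ} {θ : ℝ}
    (hH : ∀ z, HasDerivAt (fun θ => H θ z) (H' z) θ)
    (hg : ∀ z, HasDerivAt (fun θ => g θ z) (g' z) θ) :
    HasDerivAt (fun θ => ∑ z, (Real.exp (-(H θ z)) / ∑ z', Real.exp (-(H θ z'))) * g θ z)
      ((∑ z, (Real.exp (-(H θ z)) / ∑ z', Real.exp (-(H θ z'))) * g' z)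
        - (∑ z, (Real.exp (-(H θ z)) / ∑ z', Real.exp (-(H θ z'))) * (g θ z * H' z))
        + (∑ z, (Real.exp (-(H θ z)) / ∑ z', Real.exp (-(H θ z'))) * g θ z) *
          (∑ z, (Real.exp (-(H θ z)) / ∑ z', Real.exp (-(H θ z'))) * H' z)) θ := by
  refine (HasDerivAt.fun_sum fun z _ =>
    (hasDerivAt_gibbs_weight hH z).fun_mul (hg z)).congr_deriv ?_
  rw [Finset.sum_mul, ← Finset.sum_sub_distrib, ← Finset.sum_add_distrib]
  exact Finset.sum_congr rfl fun z _ => by ring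

/-- Derivative of a Gibbs expectation: for the Gibbs distribution
`p_θ z = exp(-H θ z) / ∑ exp(-H θ z')`, the map `θ ↦ ⟨g θ⟩_θ` is differentiable with
derivative `⟨∂g/∂θ⟩ - ⟨g ∂H/∂θ⟩ + ⟨g⟩⟨∂H/∂θ⟩`. -/
theorem deriv_gibbs_expectation {Z : Type*} [Fintype Z] [Nonempty Z]
    (H g : ℝ → Z → ℝ)
    (hH : ∀ z, Differentiable ℝ fun θ => H θ z)
    (hg : ∀ z, Differentiable ℝ fun θ => g θ z) :
    Differentiable ℝ
      (fun θ => ∑ z, (Real.exp (-(H θ z)) / ∑ z', Real.exp (-(H θ z'))) * g θ z) ∧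
    ∀ θ : ℝ,
      deriv (fun θ' =>
          ∑ z, (Real.exp (-(H θ' z)) / ∑ z', Real.exp (-(H θ' z'))) * g θ' z) θ =
        (∑ z, (Real.exp (-(H θ z)) / ∑ z', Real.exp (-(H θ z'))) *
            deriv (fun θ' => g θ' z) θ)
        - (∑ z, (Real.exp (-(H θ z)) / ∑ z', Real.exp (-(H θ z'))) *
            (g θ z * deriv (fun θ' => H θ' z) θ))
        + (∑ z, (Real.exp (-(H θ z)) / ∑ z', Real.exp (-(H θ z'))) * g θ z) *
          (∑ z, (Real.exp (-(H θ z)) / ∑ z', Real.exp (-(H θ z'))) *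
            deriv (fun θ' => H θ' z) θ) := by
  have key (θ : ℝ) := hasDerivAt_gibbs_expectation
    (fun z => (hH z θ).hasDerivAt) (fun z => (hg z θ).hasDerivAt)
  exact ⟨fun θ => (key θ).differentiableAt, fun θ => (key θ).deriv⟩
end

section
/- Let F : ℝ × ℝ → ℝ be twice continuously differentiable, let α ∈ ℝ, and let λ, γ : ℝ → ℝ be differentiable curves satisfying the iso-classification dynamics λ'(t) = -α · (∂²F/∂γ²)(λ(t), γ(t)) and γ'(t) = α · (∂²F/∂λ∂γ)(λ(t), γ(t)) for all t. Then the function t ↦ (∂F/∂γ)(λ(t), γ(t)) is constant, i.e. its derivative vanishes for all t. -/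
/-- `∂F/∂λ`. -/
noncomputable def pdL (F : ℝ × ℝ → ℝ) (a b : ℝ) : ℝ := deriv (fun x => F (x, b)) a
/-- `∂F/∂γ`. -/
noncomputable def pdG (F : ℝ × ℝ → ℝ) (a b : ℝ) : ℝ := deriv (fun y => F (a, y)) b
/-- `∂²F/∂γ²`. -/
noncomputable def pdGG (F : ℝ × ℝ → ℝ) (a b : ℝ) : ℝ := deriv (fun y => pdG F a y) b
/-- `∂²F/∂λ∂γ`. -/
noncomputable def pdLG (F : ℝ × ℝ → ℝ) (a b : ℝ) : ℝ := deriv (fun x => pdG F x b) a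

theorem pdG_eq_fderiv {F : ℝ × ℝ → ℝ} (hF : Differentiable ℝ F) (a b : ℝ) :
    pdG F a b = fderiv ℝ F (a, b) (0, 1) :=
  ((hF (a, b)).hasFDerivAt.comp_hasDerivAt b
    ((hasDerivAt_const b a).prodMk (hasDerivAt_id b))).deriv

theorem differentiable_pdG {F : ℝ × ℝ → ℝ} (hF : ContDiff ℝ 2 F) :
    Differentiable ℝ (fun p : ℝ × ℝ => pdG F p.1 p.2) := by
  simp only [pdG_eq_fderiv (hF.differentiable two_ne_zero)]
  exact ((hF.fderiv_right (m := 1) (by norm_num)).differentiable one_ne_zero).clm_apply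
    (differentiable_const _)

/-- Chain rule for `∂F/∂γ` along a plane curve. -/
theorem hasDerivAt_pdG_comp {F : ℝ × ℝ → ℝ} (hF : ContDiff ℝ 2 F) {l g : ℝ → ℝ} {l' g' t : ℝ}
    (hl : HasDerivAt l l' t) (hg : HasDerivAt g g' t) :
    HasDerivAt (fun s => pdG F (l s) (g s))
      (l' * pdLG F (l t) (g t) + g' * pdGG F (l t) (g t)) t := by
  have hG := (differentiable_pdG hF (l t, g t)).hasFDerivAt
  have hL : pdLG F (l t) (g t) = fderiv ℝ (fun p : ℝ × ℝ => pdG F p.1 p.2) (l t, g t) (1, 0) :=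
    (hG.comp_hasDerivAt (f := fun x => (x, g t)) (l t)
      ((hasDerivAt_id (l t)).prodMk (hasDerivAt_const (l t) (g t)))).deriv
  have hGG : pdGG F (l t) (g t) = fderiv ℝ (fun p : ℝ × ℝ => pdG F p.1 p.2) (l t, g t) (0, 1) :=
    (hG.comp_hasDerivAt (f := fun y => (l t, y)) (g t)
      ((hasDerivAt_const (g t) (l t)).prodMk (hasDerivAt_id (g t)))).deriv
  have hv : ((l', g') : ℝ × ℝ) = l' • (1, 0) + g' • (0, 1) := by simp
  have h := hG.comp_hasDerivAt t (hl.prodMk hg)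
  rw [hv, map_add, map_smul, map_smul, smul_eq_mul, smul_eq_mul, ← hL, ← hGG] at h
  exact h

/-- Along the iso-classification dynamics `λ' = -α ∂²F/∂γ²`, `γ' = α ∂²F/∂λ∂γ`,
the classification loss `C = ∂F/∂γ` stays constant: its time derivative vanishes. -/
theorem isoClassification_C_constant (F : ℝ × ℝ → ℝ) (hF : ContDiff ℝ 2 F)
    (α : ℝ) (l g : ℝ → ℝ)
    (hl : ∀ t, HasDerivAt l (-α * pdGG F (l t) (g t)) t)
    (hg : ∀ t, HasDerivAt g (α * pdLG F (l t) (g t)) t) :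
    ∀ t, deriv (fun s => pdG F (l s) (g s)) t = 0 := by
  intro t
  rw [(hasDerivAt_pdG_comp hF (hl t) (hg t)).deriv]
  ring
end

section
/- Let F : ℝ × ℝ → ℝ be twice continuously differentiable, let α ∈ ℝ, and let λ, γ : ℝ → ℝ be differentiable curves satisfying λ'(t) = -α · (∂²F/∂γ²)(λ(t), γ(t)) and γ'(t) = α · (∂²F/∂λ∂γ)(λ(t), γ(t)) for all t. Then for all t, the derivative of t ↦ (∂F/∂λ)(λ(t), γ(t)) equals -α · ((∂²F/∂λ²)·(∂²F/∂γ²) - (∂²F/∂λ∂γ)²) evaluated at (λ(t), γ(t)), i.e. it equals -α times the determinant of the Hessian of F at (λ(t), γ(t)). -/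
/-- `∂²F/∂λ²`. -/
noncomputable def pdLL (F : ℝ × ℝ → ℝ) (a b : ℝ) : ℝ := deriv (fun x => pdL F x b) a
theorem pdL_eq_fderiv {F : ℝ × ℝ → ℝ} (hF : Differentiable ℝ F) (a b : ℝ) :
    pdL F a b = fderiv ℝ F (a, b) (1, 0) :=
  ((hF (a, b)).hasFDerivAt.comp_hasDerivAt a
    ((hasDerivAt_id a).prodMk (hasDerivAt_const a b))).deriv

/-- The derivative of a directional derivative of `F` along a curve. -/
theorem ContDiff.hasDerivAt_fderiv_apply_comp {F : ℝ × ℝ → ℝ} (hF : ContDiff ℝ 2 F)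
    (v : ℝ × ℝ) {l g : ℝ → ℝ} {l' g' t : ℝ} (hl : HasDerivAt l l' t) (hg : HasDerivAt g g' t) :
    HasDerivAt (fun s => fderiv ℝ F (l s, g s) v)
      (fderiv ℝ (fderiv ℝ F) (l t, g t) (l', g') v) t := by
  have hG : Differentiable ℝ (fderiv ℝ F) :=
    (hF.fderiv_right (m := 1) (by norm_num)).differentiable one_ne_zero
  have h := (hG (l t, g t)).hasFDerivAt.comp_hasDerivAt t (hl.prodMk hg)
  simpa using h.clm_apply (hasDerivAt_const t v)

theorem pdLL_eq_fderiv_fderiv {F : ℝ × ℝ → ℝ} (hF : ContDiff ℝ 2 F) (a b : ℝ) :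
    pdLL F a b = fderiv ℝ (fderiv ℝ F) (a, b) (1, 0) (1, 0) := by
  simp only [pdLL, pdL_eq_fderiv (hF.differentiable two_ne_zero)]
  exact (hF.hasDerivAt_fderiv_apply_comp (1, 0) (hasDerivAt_id a) (hasDerivAt_const a b)).deriv

theorem pdLG_eq_fderiv_fderiv {F : ℝ × ℝ → ℝ} (hF : ContDiff ℝ 2 F) (a b : ℝ) :
    pdLG F a b = fderiv ℝ (fderiv ℝ F) (a, b) (1, 0) (0, 1) := by
  simp only [pdLG, pdG_eq_fderiv (hF.differentiable two_ne_zero)]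
  exact (hF.hasDerivAt_fderiv_apply_comp (0, 1) (hasDerivAt_id a) (hasDerivAt_const a b)).deriv

/-- Along the iso-classification dynamics `λ' = -α ∂²F/∂γ²`, `γ' = α ∂²F/∂λ∂γ`,
the distortion `D = ∂F/∂λ` evolves as `Ḋ = -α·det(Hess F)`. -/
theorem isoClassification_D_deriv (F : ℝ × ℝ → ℝ) (hF : ContDiff ℝ 2 F)
    (α : ℝ) (l g : ℝ → ℝ)
    (hl : ∀ t, HasDerivAt l (-α * pdGG F (l t) (g t)) t)
    (hg : ∀ t, HasDerivAt g (α * pdLG F (l t) (g t)) t) :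
    ∀ t, deriv (fun s => pdL F (l s) (g s)) t =
      -α * (pdLL F (l t) (g t) * pdGG F (l t) (g t) - (pdLG F (l t) (g t)) ^ 2) := by
  intro t
  have hsymm : fderiv ℝ (fderiv ℝ F) (l t, g t) (0, 1) (1, 0) =
      fderiv ℝ (fderiv ℝ F) (l t, g t) (1, 0) (0, 1) :=
    (hF.contDiffAt.isSymmSndFDerivAt (by simp)).eq _ _
  have hsplit (x y : ℝ) : ((x, y) : ℝ × ℝ) = x • (1, 0) + y • (0, 1) := by simp
  simp only [pdL_eq_fderiv (hF.differentiable two_ne_zero)]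
  rw [(hF.hasDerivAt_fderiv_apply_comp (1, 0) (hl t) (hg t)).deriv, hsplit (-α * _),
    map_add, map_smul, map_smul, add_apply, smul_apply,
    smul_apply, hsymm, ← pdLL_eq_fderiv_fderiv hF, ← pdLG_eq_fderiv_fderiv hF,
    smul_eq_mul, smul_eq_mul]
  ring
end

section
/- Let F : ℝ × ℝ → ℝ be twice continuously differentiable such that at every point of ℝ² the 2×2 Hessian of F is negative definite, let α > 0, and let λ, γ : ℝ → ℝ be differentiable curves satisfying λ'(t) = -α · (∂²F/∂γ²)(λ(t), γ(t)) and γ'(t) = α · (∂²F/∂λ∂γ)(λ(t), γ(t)) for all t. Then λ'(t) > 0 for all t (λ is strictly increasing) and the derivative of t ↦ (∂F/∂λ)(λ(t), γ(t)) is strictly negative for all t (the distortion D = ∂F/∂λ strictly decreases along the dynamics). -/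
open Matrix

/-- `∂²F/∂γ∂λ`. -/
noncomputable def pdGL (F : ℝ × ℝ → ℝ) (a b : ℝ) : ℝ := deriv (fun y => pdL F a y) b

/-- The Hessian of `F : ℝ × ℝ → ℝ` at `(a, b)`. -/
noncomputable def hessF (F : ℝ × ℝ → ℝ) (a b : ℝ) : Matrix (Fin 2) (Fin 2) ℝ :=
  !![pdLL F a b, pdLG F a b; pdGL F a b, pdGG F a b]

/-- A real matrix is negative definite if its quadratic form is strictly negative
on nonzero vectors. -/
def NegDefMat {n : Type*} [Fintype n] (M : Matrix n n ℝ) : Prop :=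
  ∀ v : n → ℝ, v ≠ 0 → v ⬝ᵥ M.mulVec v < 0

lemma deriv_comp_prodMk_left {f : ℝ × ℝ → ℝ} {a b : ℝ} (hf : DifferentiableAt ℝ f (a, b)) :
    deriv (fun x => f (x, b)) a = fderiv ℝ f (a, b) (1, 0) :=
  (hf.hasFDerivAt.comp_hasDerivAt a ((hasDerivAt_id a).prodMk (hasDerivAt_const a b))).deriv

lemma deriv_comp_prodMk_right {f : ℝ × ℝ → ℝ} {a b : ℝ} (hf : DifferentiableAt ℝ f (a, b)) :
    deriv (fun y => f (a, y)) b = fderiv ℝ f (a, b) (0, 1) :=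
  (hf.hasFDerivAt.comp_hasDerivAt b ((hasDerivAt_const b a).prodMk (hasDerivAt_id b))).deriv

/-- The chain rule along a planar curve, in terms of partial derivatives. -/
lemma hasDerivAt_comp_curve {f : ℝ × ℝ → ℝ} {l g : ℝ → ℝ} {l' g' t : ℝ}
    (hf : DifferentiableAt ℝ f (l t, g t)) (hl : HasDerivAt l l' t) (hg : HasDerivAt g g' t) :
    HasDerivAt (fun s => f (l s, g s))
      (l' * deriv (fun x => f (x, g t)) (l t) + g' * deriv (fun y => f (l t, y)) (g t)) t := by
  have h := hf.hasFDerivAt.comp_hasDerivAt t (hl.prodMk hg)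
  have hv : ((l', g') : ℝ × ℝ) = l' • (1, 0) + g' • (0, 1) := by simp
  rw [hv, map_add, map_smul, map_smul, smul_eq_mul, smul_eq_mul,
    ← deriv_comp_prodMk_left hf, ← deriv_comp_prodMk_right hf] at h
  exact h

lemma differentiable_pdL {F : ℝ × ℝ → ℝ} (hF : ContDiff ℝ 2 F) :
    Differentiable ℝ (fun p : ℝ × ℝ => pdL F p.1 p.2) := by
  have h : (fun p : ℝ × ℝ => pdL F p.1 p.2) = fun p => fderiv ℝ F p (1, 0) :=
    funext fun _ => deriv_comp_prodMk_left (hF.differentiable two_ne_zero _)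
  rw [h]
  have hd : Differentiable ℝ (fderiv ℝ F) :=
    (hF.fderiv_right (m := 1) (by norm_num)).differentiable one_ne_zero
  exact hd.clm_apply (differentiable_const _)

lemma NegDefMat.apply_one_one_neg {p q r s : ℝ} (h : NegDefMat !![p, q; r, s]) : s < 0 := by
  simpa [mulVec, dotProduct, Fin.sum_univ_two] using h ![0, 1] (by simp)

lemma NegDefMat.det_pos {p q r s : ℝ} (h : NegDefMat !![p, q; r, s]) : 0 < p * s - q * r := by
  have hs := h.apply_one_one_neg
  have hv := h ![s, -q] (by simp [hs.ne])
  simp only [mulVec, dotProduct, Fin.sum_univ_two, of_apply, cons_val_zero, cons_val_one] at hv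
  have hprod : s * (p * s - q * r) < 0 := by linarith
  exact pos_of_mul_neg_right hprod hs.le

/-- If `Hess F ≺ 0` everywhere, then along the iso-classification dynamics
`λ' = -α ∂²F/∂γ²`, `γ' = α ∂²F/∂λ∂γ` with `α > 0`, the multiplier `λ` strictly
increases and the distortion `D = ∂F/∂λ` strictly decreases. -/
theorem isoClassification_monotone (F : ℝ × ℝ → ℝ) (hF : ContDiff ℝ 2 F)
    (hHess : ∀ a b : ℝ, NegDefMat (hessF F a b))
    (α : ℝ) (hα : 0 < α) (l g : ℝ → ℝ)
    (hl : ∀ t, HasDerivAt l (-α * pdGG F (l t) (g t)) t)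
    (hg : ∀ t, HasDerivAt g (α * pdLG F (l t) (g t)) t) :
    ∀ t, 0 < deriv l t ∧ deriv (fun s => pdL F (l s) (g s)) t < 0 := by
  intro t
  have hH : NegDefMat !![pdLL F (l t) (g t), pdLG F (l t) (g t);
      pdGL F (l t) (g t), pdGG F (l t) (g t)] := hHess (l t) (g t)
  constructor
  · rw [(hl t).deriv]
    exact mul_pos_of_neg_of_neg (neg_neg_of_pos hα) hH.apply_one_one_neg
  · have hD : HasDerivAt (fun s => pdL F (l s) (g s))
        (-α * pdGG F (l t) (g t) * pdLL F (l t) (g t) +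
          α * pdLG F (l t) (g t) * pdGL F (l t) (g t)) t :=
      hasDerivAt_comp_curve (differentiable_pdL hF _) (hl t) (hg t)
    rw [hD.deriv]
    linarith [mul_pos hα hH.det_pos]
end
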